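/- arXiv:2202.01632 — 3 statements merged into one kernel-verified Lean document; each statement's English description precedes it below -/
import Mathlib

section
/- For every k ∈ ℕ and all integers 1 ≤ i < j, the set of pairs (x,ω) ∈ Ω^ℕ × Ω^k such that the word ω occurs in x at both positions i and j (i.e., x[i,i+k) = ω and x[j,j+k) = ω) has μ^ℕ × μ^k measure exactly b^{−2k}; in particular E[I_i I_j] = b^{−2k} = E[I_i]·E[I_j] even when |i − j| < k. -/
open MeasureTheory Filter

/-- The uniform product measure μ^k on Ω^k, Ω = Fin b: normalized counting measure. -/
noncomputable def muK (b k : ℕ) : Measure (Fin k → Fin b) :=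
  ((b : ENNReal) ^ k)⁻¹ • Measure.count

/-- ν is the product measure μ^ℕ of uniform measures on Ω = Fin b over Ω^ℕ:
every cylinder of length n has measure b^{-n}. -/
def IsUnifProductMeasure (b : ℕ) (ν : Measure (ℕ → Fin b)) : Prop :=
  ∀ (n : ℕ) (w : Fin n → Fin b),
    ν {x | ∀ t : Fin n, x (t : ℕ) = w t} = ((b : ENNReal)⁻¹) ^ n

/-- The word w (of length k) occurs in x at position j (positions numbered from 1):
I_j(x,w) = 1. -/
def OccursAt {b k : ℕ} (x : ℕ → Fin b) (j : ℕ) (w : Fin k → Fin b) : Prop :=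
  ∀ t : Fin k, x (j - 1 + (t : ℕ)) = w t

instance {b k : ℕ} (x : ℕ → Fin b) (j : ℕ) (w : Fin k → Fin b) :
    Decidable (OccursAt x j w) := by unfold OccursAt; infer_instance

/-- M_k^x(S)(w) = Σ_{j ∈ ℕ ∩ b^k S} I_j(x,w): the number of positive integers j with
j/b^k ∈ S at which w occurs in x. -/
noncomputable def Mx (b k : ℕ) (S : Set ℝ) (x : ℕ → Fin b) (w : Fin k → Fin b) : ℕ :=
  {j : ℕ | 1 ≤ j ∧ ((j : ℝ) / (b : ℝ) ^ k) ∈ S ∧ OccursAt x j w}.ncard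

/-- Z^λ_{i,k}(x): proportion of words of length k occurring exactly i times
among positions 1 ≤ j ≤ λ b^k of x. -/
noncomputable def Z (b k i : ℕ) (lam : ℝ) (x : ℕ → Fin b) : ℝ :=
  ((Finset.univ.filter (fun w : Fin k → Fin b =>
      ((Finset.Icc 1 ⌊lam * (b : ℝ) ^ k⌋₊).filter (fun j => OccursAt x j w)).card = i)).card : ℝ)
    / (b : ℝ) ^ k

/-- x is λ-Poisson generic. -/
def LamPoissonGeneric (b : ℕ) (lam : ℝ) (x : ℕ → Fin b) : Prop :=
  ∀ i : ℕ, Tendsto (fun k : ℕ => Z b k i lam x) atTop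
    (nhds (Real.exp (-lam) * lam ^ i / (Nat.factorial i : ℝ)))

/-- x is Poisson generic. -/
def PoissonGeneric (b : ℕ) (x : ℕ → Fin b) : Prop :=
  ∀ lam : ℝ, 0 < lam → LamPoissonGeneric b lam x

/-- S ⊆ [0,∞) is a finite union of pairwise disjoint intervals with rational endpoints. -/
def IsFinRatIntervalUnion (S : Set ℝ) : Prop :=
  ∃ (n : ℕ) (p q : Fin n → ℚ), (∀ m, 0 ≤ p m) ∧
    (Pairwise fun m l : Fin n =>
      Disjoint (Set.Ioo ((p m : ℝ)) ((q m : ℝ))) (Set.Ioo ((p l : ℝ)) ((q l : ℝ)))) ∧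
    S = ⋃ m, Set.Ioo ((p m : ℝ)) ((q m : ℝ))

/-- Total variation distance between two laws on ℕ (given as set functions). -/
noncomputable def dTV (P Q : Set ℕ → ℝ) : ℝ := ⨆ A : Set ℕ, |P A - Q A|

/-- The law on ℕ of M_k(S) under μ^ℕ × μ^k. -/
noncomputable def lawM (b k : ℕ) (ν : Measure (ℕ → Fin b)) (S : Set ℝ) (A : Set ℕ) : ℝ :=
  ((ν.prod (muK b k)) {p : (ℕ → Fin b) × (Fin k → Fin b) | Mx b k S p.1 p.2 ∈ A}).toReal

/-- The law on ℕ of M_k^x(S) under μ^k. -/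
noncomputable def lawMx (b k : ℕ) (x : ℕ → Fin b) (S : Set ℝ) (A : Set ℕ) : ℝ :=
  ((muK b k) {w : Fin k → Fin b | Mx b k S x w ∈ A}).toReal

/-- The Poisson law with mean λ, as a set function on ℕ. -/
noncomputable def poissonLaw (lam : ℝ) (A : Set ℕ) : ℝ :=
  ∑' i : A, Real.exp (-lam) * lam ^ (i : ℕ) / (Nat.factorial (i : ℕ) : ℝ)

/-- Given that the first `n` symbols lie in `S`, the next symbol equals a prescribed function of
them with probability `1 / b`. -/
lemma IsUnifProductMeasure.measure_next_eq {b : ℕ} {ν : Measure (ℕ → Fin b)}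
    (hν : IsUnifProductMeasure b ν) (n : ℕ) (S : Finset (Fin n → Fin b))
    (g : (Fin n → Fin b) → Fin b) :
    ν {x | (fun t : Fin n => x t) ∈ S ∧ x n = g (fun t : Fin n => x t)}
      = (b : ENNReal)⁻¹ * ν {x | (fun t : Fin n => x t) ∈ S} := by
  have hprefix : ν {x | (fun t : Fin n => x t) ∈ S} = ∑ w ∈ S, ν {x | ∀ t : Fin n, x t = w t} := by
    rw [← measure_biUnion_finset]
    · congr 1
      ext x
      simp [← funext_iff]
    · intro w _ w' _ hww
      refine Set.disjoint_left.2 fun x hx hx' => hww (funext fun t => ?_)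
      rw [← hx t, hx' t]
    · intro w _
      measurability
  have hnext : ν {x | (fun t : Fin n => x t) ∈ S ∧ x n = g (fun t : Fin n => x t)} =
      ∑ w ∈ S, ν {x | ∀ t : Fin (n + 1), x t = Fin.snoc (α := fun _ => Fin b) w (g w) t} := by
    have hsnoc (w : Fin n → Fin b) (x : ℕ → Fin b) :
        (∀ t : Fin (n + 1), x t = Fin.snoc (α := fun _ => Fin b) w (g w) t) ↔
          (fun t : Fin n => x t) = w ∧ x n = g w := by
      simp [Fin.forall_fin_succ', funext_iff]
    rw [← measure_biUnion_finset]
    · congr 1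
      ext x
      simp only [hsnoc, Set.mem_ofPred_eq, Set.mem_iUnion, exists_prop]
      exact ⟨fun h => ⟨_, h.1, rfl, h.2⟩, by rintro ⟨w, hw, rfl, h⟩; exact ⟨hw, h⟩⟩
    · intro w _ w' _ hww
      refine Set.disjoint_left.2 fun x hx hx' => hww ?_
      exact ((hsnoc w x).1 hx).1.symm.trans ((hsnoc w' x).1 hx').1
    · intro w _
      measurability
  rw [hprefix, hnext, Finset.mul_sum]
  refine Finset.sum_congr rfl fun w _ => ?_
  rw [hν, hν, pow_succ']

/-- The blocks of length `k` starting at two distinct indices agree with probability `b⁻ᵏ`,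
even if they overlap. -/
lemma IsUnifProductMeasure.measure_blocks_eq {b : ℕ} {ν : Measure (ℕ → Fin b)}
    (hν : IsUnifProductMeasure b ν) {p q : ℕ} (hpq : p < q) (k : ℕ) :
    ν {x | ∀ t < k, x (p + t) = x (q + t)} = (b : ENNReal)⁻¹ ^ k := by
  induction k with
  | zero => simpa using hν 0 Fin.elim0
  | succ k ih =>
    let S : Finset (Fin (q + k) → Fin b) := Finset.univ.filter fun w =>
      ∀ t (ht : t < k), w ⟨p + t, by omega⟩ = w ⟨q + t, by omega⟩
    have h := hν.measure_next_eq (q + k) S (fun w => w ⟨p + k, by omega⟩)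
    simp only [S, Finset.mem_filter, Finset.mem_univ, true_and] at h
    rw [pow_succ', ← ih, ← h]
    congr 1
    ext x
    simp only [Set.mem_ofPred_eq, Nat.forall_lt_succ_right, eq_comm (a := x (q + k))]

lemma muK_singleton {b k : ℕ} (w : Fin k → Fin b) : muK b k {w} = (b : ENNReal)⁻¹ ^ k := by
  simp [muK, ENNReal.inv_pow]

lemma isFiniteMeasure_muK {b : ℕ} (hb : b ≠ 0) (k : ℕ) : IsFiniteMeasure (muK b k) := by
  have hc : ((b : ENNReal) ^ k)⁻¹ ≠ ⊤ := by simp [hb]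
  exact Measure.smul_finite _ hc

lemma occursAt_iff {b k : ℕ} (x : ℕ → Fin b) (j : ℕ) (w : Fin k → Fin b) :
    OccursAt x j w ↔ w = fun t : Fin k => x (j - 1 + t) := by
  simp only [OccursAt, funext_iff, eq_comm]

lemma measurableSet_occursAt (b k j : ℕ) :
    MeasurableSet {pr : (ℕ → Fin b) × (Fin k → Fin b) | OccursAt pr.1 j pr.2} := by
  simp only [OccursAt, Set.ofPred_forall]
  exact MeasurableSet.iInter fun t => measurableSet_eq_fun (by fun_prop) (by fun_prop)

/-- A random word of length `k` occurs at a given position with probability `b⁻ᵏ`. -/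
lemma IsUnifProductMeasure.prod_occursAt {b : ℕ} (hb : b ≠ 0) {ν : Measure (ℕ → Fin b)}
    (hν : IsUnifProductMeasure b ν) (k j : ℕ) :
    (ν.prod (muK b k)) {pr : (ℕ → Fin b) × (Fin k → Fin b) | OccursAt pr.1 j pr.2}
      = (b : ENNReal)⁻¹ ^ k := by
  have := isFiniteMeasure_muK hb k
  have huniv : ν Set.univ = 1 := by simpa using hν 0 Fin.elim0
  rw [Measure.prod_apply (measurableSet_occursAt b k j)]
  simp [occursAt_iff, muK_singleton, huniv]

/-- A random word of length `k` occurs at two given distinct positions with probability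
`b⁻²ᵏ`. -/
lemma IsUnifProductMeasure.prod_occursAt_and {b : ℕ} (hb : b ≠ 0) {ν : Measure (ℕ → Fin b)}
    (hν : IsUnifProductMeasure b ν) (k : ℕ) {i j : ℕ} (hi : 1 ≤ i) (hij : i < j) :
    (ν.prod (muK b k))
        {pr : (ℕ → Fin b) × (Fin k → Fin b) | OccursAt pr.1 i pr.2 ∧ OccursAt pr.1 j pr.2}
      = (b : ENNReal)⁻¹ ^ (2 * k) := by
  have := isFiniteMeasure_muK hb k
  let D : Set (ℕ → Fin b) := {x | ∀ t < k, x (i - 1 + t) = x (j - 1 + t)}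
  have hD : MeasurableSet D := by
    simp only [D, Set.ofPred_forall]
    exact MeasurableSet.iInter fun t => MeasurableSet.iInter fun _ =>
      measurableSet_eq_fun (by fun_prop) (by fun_prop)
  have hslice (x : ℕ → Fin b) :
      muK b k (Prod.mk x ⁻¹' {pr | OccursAt pr.1 i pr.2 ∧ OccursAt pr.1 j pr.2})
        = D.indicator (fun _ => (b : ENNReal)⁻¹ ^ k) x := by
    by_cases hx : x ∈ D
    · rw [Set.indicator_of_mem hx, ← muK_singleton fun t : Fin k => x (i - 1 + t)]
      congr 1
      ext w
      have heq : (fun t : Fin k => x (i - 1 + t)) = fun t : Fin k => x (j - 1 + t) :=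
        funext fun t => hx t t.2
      simp [occursAt_iff, heq]
    · rw [Set.indicator_of_notMem hx]
      convert measure_empty (μ := muK b k)
      refine Set.eq_empty_of_forall_notMem fun w hw => hx fun t ht => ?_
      exact (hw.1 ⟨t, ht⟩).trans (hw.2 ⟨t, ht⟩).symm
  have hmeas := (measurableSet_occursAt b k i).inter (measurableSet_occursAt b k j)
  rw [Set.ofPred_and, Measure.prod_apply hmeas, ← Set.ofPred_and]
  simp_rw [hslice]
  rw [lintegral_indicator_const hD, hν.measure_blocks_eq (by omega), ← pow_add, two_mul]

theorem stmt5 (b : ℕ) (hb : 2 ≤ b) (ν : Measure (ℕ → Fin b))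
    (hν : IsUnifProductMeasure b ν) (k : ℕ) (i j : ℕ) (hi : 1 ≤ i) (hij : i < j) :
    (ν.prod (muK b k))
        {pr : (ℕ → Fin b) × (Fin k → Fin b) | OccursAt pr.1 i pr.2 ∧ OccursAt pr.1 j pr.2}
      = ((b : ENNReal)⁻¹) ^ (2 * k) ∧
    (ν.prod (muK b k))
        {pr : (ℕ → Fin b) × (Fin k → Fin b) | OccursAt pr.1 i pr.2 ∧ OccursAt pr.1 j pr.2}
      = (ν.prod (muK b k)) {pr : (ℕ → Fin b) × (Fin k → Fin b) | OccursAt pr.1 i pr.2} *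
        (ν.prod (muK b k)) {pr : (ℕ → Fin b) × (Fin k → Fin b) | OccursAt pr.1 j pr.2} := by
  have hb0 : b ≠ 0 := by omega
  have hand := hν.prod_occursAt_and hb0 k hi hij
  refine ⟨hand, ?_⟩
  rw [hand, hν.prod_occursAt hb0, hν.prod_occursAt hb0, ← pow_add, two_mul]
end

section
/- Let k ∈ ℕ, let i < j be positive integers with j − i < k, and let ω ∈ Ω^k be a word satisfying ω(j−i, k] = ω[1, k−(j−i)]. Then μ^ℕ({x ∈ Ω^ℕ : x[i,i+k) = ω and x[j,j+k) = ω}) = b^{−k − (j−i)}. -/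
open MeasureTheory Filter

/-- A shifted cylinder has the same measure as the cylinder itself. -/
theorem IsUnifProductMeasure.measure_shifted_cylinder {b : ℕ} (hb : b ≠ 0)
    {ν : Measure (ℕ → Fin b)} (hν : IsUnifProductMeasure b ν) (m n : ℕ) (v : Fin n → Fin b) :
    ν {x | ∀ t : Fin n, x (m + (t : ℕ)) = v t} = ((b : ENNReal)⁻¹) ^ n := by
  have hunion : {x : ℕ → Fin b | ∀ t : Fin n, x (m + (t : ℕ)) = v t}
      = ⋃ u : Fin m → Fin b, {x | ∀ t : Fin (m + n), x (t : ℕ) = Fin.append u v t} := by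
    ext x
    simp only [Set.mem_ofPred_eq, Set.mem_iUnion, Fin.forall_fin_add, Fin.append_left,
      Fin.append_right, Fin.val_castAdd, Fin.val_natAdd]
    exact ⟨fun h => ⟨fun t => x t, fun _ => rfl, h⟩, fun ⟨_, _, h⟩ => h⟩
  rw [hunion, measure_iUnion]
  · simp only [hν (m + n), tsum_fintype, Finset.sum_const, Finset.card_univ, Fintype.card_fun,
      Fintype.card_fin, nsmul_eq_mul, Nat.cast_pow]
    rw [pow_add, ← mul_assoc, ← mul_pow, ENNReal.mul_inv_cancel (by exact_mod_cast hb)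
      (ENNReal.natCast_ne_top b), one_pow, one_mul]
  · intro u u' huu'
    refine Set.disjoint_left.2 fun x hx hx' => huu' (funext fun t => ?_)
    have h := (hx (Fin.castAdd n t)).symm.trans (hx' (Fin.castAdd n t))
    simpa using h
  · intro u
    exact MeasurableSet.congr (MeasurableSet.iInter fun t : Fin (m + n) =>
      measurable_pi_apply (t : ℕ) (measurableSet_singleton (Fin.append u v t)))
      (by ext x; simp)

theorem stmt7 (b : ℕ) (hb : 2 ≤ b) (ν : Measure (ℕ → Fin b))
    (hν : IsUnifProductMeasure b ν) (k : ℕ) (i j : ℕ) (hi : 1 ≤ i) (hij : i < j)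
    (hjk : j - i < k) (w : Fin k → Fin b)
    (hw : ∀ s t : Fin k, (s : ℕ) = (t : ℕ) + (j - i) → w s = w t) :
    ν {x : ℕ → Fin b | OccursAt x i w ∧ OccursAt x j w}
      = ((b : ENNReal)⁻¹) ^ (k + (j - i)) := by
  have hset : {x : ℕ → Fin b | OccursAt x i w ∧ OccursAt x j w}
      = {x | ∀ t : Fin (k + (j - i)), x (i - 1 + (t : ℕ)) =
          if h : (t : ℕ) < k then w ⟨t, h⟩ else w ⟨t - (j - i), by omega⟩} := by
    ext x
    simp only [Set.mem_ofPred_eq, OccursAt]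
    constructor
    · rintro ⟨h₁, h₂⟩ t
      split_ifs with h
      · exact h₁ ⟨t, h⟩
      · rw [← h₂ ⟨t - (j - i), by omega⟩]
        congr 1
        dsimp only
        omega
    · intro hx
      refine ⟨fun t => ?_, fun t => ?_⟩
      · simpa using hx ⟨t, by omega⟩
      · have h := hx ⟨t + (j - i), by omega⟩
        dsimp only at h
        rw [show j - 1 + (t : ℕ) = i - 1 + (t + (j - i)) by omega, h]
        split_ifs with hlt
        · exact hw _ _ rfl
        · simp
  rw [hset]
  exact hν.measure_shifted_cylinder (by omega) _ _ _
end

section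
/- Let S ⊆ [0,∞) be a finite union of disjoint bounded intervals with rational endpoints. Then the total variation distance between the law of M_k(S) under μ^ℕ × μ^k and the Poisson distribution with mean |S| tends to 0 as k → ∞. -/
open MeasureTheory Filter

theorem hasSum_pow_div_factorial (r : ℝ) :
    HasSum (fun n : ℕ => r ^ n / (n.factorial : ℝ)) (Real.exp r) := by
  rw [Real.exp_eq_exp_ℝ]
  exact NormedSpace.expSeries_div_hasSum_exp r

theorem hasSum_indicator_poissonLaw (r : ℝ) (A : Set ℕ) :
    HasSum (fun n : ℕ => r ^ n / (n.factorial : ℝ) * A.indicator 1 n)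
      (Real.exp r * poissonLaw r A) := by
  have hs : Summable (A.indicator fun n : ℕ => Real.exp (-r) * r ^ n / (n.factorial : ℝ)) := by
    refine Summable.indicator ?_ A
    simpa only [mul_div_assoc] using (hasSum_pow_div_factorial r).summable.mul_left (Real.exp (-r))
  have h := hs.hasSum.mul_left (Real.exp r)
  rw [← tsum_subtype] at h
  have hfun : (fun n : ℕ => r ^ n / (n.factorial : ℝ) * A.indicator 1 n) = fun n =>
      Real.exp r * A.indicator (fun n : ℕ => Real.exp (-r) * r ^ n / (n.factorial : ℝ)) n := by
    ext n
    by_cases hn : n ∈ A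
    · simp only [hn, Set.indicator_of_mem, Pi.one_apply, Real.exp_neg]
      field_simp
    · simp [hn]
  rw [hfun]
  exact h

theorem poissonLaw_mem_Icc {r : ℝ} (hr : 0 ≤ r) (A : Set ℕ) :
    poissonLaw r A ∈ Set.Icc (0 : ℝ) 1 := by
  refine ⟨tsum_nonneg fun i => by positivity, ?_⟩
  have h : Real.exp r * poissonLaw r A ≤ Real.exp r := by
    refine hasSum_le (fun n => ?_) (hasSum_indicator_poissonLaw r A) (hasSum_pow_div_factorial r)
    refine mul_le_of_le_one_right (by positivity) ?_
    exact Set.indicator_le_self' (fun _ _ => zero_le_one) n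
  nlinarith [Real.exp_pos r]

/-- The solution of the Stein equation for the Poisson law with mean `r` and test function `h`. -/
noncomputable def steinSolution (r : ℝ) (h : ℕ → ℝ) : ℕ → ℝ
  | 0 => 0
  | n + 1 => -∑' m : ℕ, r ^ m * (n.factorial / (n + m + 1).factorial : ℝ) * h (n + m + 1)

theorem factorial_div_factorial_le (n m : ℕ) :
    (n.factorial / (n + m + 1).factorial : ℝ) ≤ 1 / m.factorial := by
  rw [div_le_div_iff₀ (by positivity) (by positivity), one_mul]
  have h₁ := Nat.le_of_dvd (Nat.factorial_pos _) (Nat.factorial_mul_factorial_dvd_factorial_add n m)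
  have h₂ : (n + m).factorial ≤ (n + m + 1).factorial := Nat.factorial_le (Nat.le_succ _)
  exact_mod_cast h₁.trans h₂

theorem norm_steinSolution_term_le {r : ℝ} (hr : 0 ≤ r) {h : ℕ → ℝ} (hh : ∀ n, |h n| ≤ 1)
    (n m : ℕ) :
    ‖r ^ m * (n.factorial / (n + m + 1).factorial : ℝ) * h (n + m + 1)‖
      ≤ r ^ m / m.factorial := by
  rw [norm_mul, Real.norm_of_nonneg (by positivity), Real.norm_eq_abs]
  calc _ ≤ r ^ m * (1 / m.factorial : ℝ) * 1 :=
        mul_le_mul (mul_le_mul_of_nonneg_left (factorial_div_factorial_le n m) (by positivity))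
          (hh _) (abs_nonneg _) (by positivity)
    _ = _ := by ring

theorem abs_steinSolution_le {r : ℝ} (hr : 0 ≤ r) {h : ℕ → ℝ} (hh : ∀ n, |h n| ≤ 1) (n : ℕ) :
    |steinSolution r h n| ≤ Real.exp r := by
  cases n with
  | zero => simpa [steinSolution] using (Real.exp_pos r).le
  | succ n =>
    rw [steinSolution, abs_neg]
    exact tsum_of_norm_bounded (hasSum_pow_div_factorial r) (norm_steinSolution_term_le hr hh n)

theorem steinSolution_equation {r : ℝ} (hr : 0 ≤ r) {h : ℕ → ℝ} (hh : ∀ n, |h n| ≤ 1)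
    (h0 : HasSum (fun n : ℕ => r ^ n / (n.factorial : ℝ) * h n) 0) (n : ℕ) :
    r * steinSolution r h (n + 1) - n * steinSolution r h n = h n := by
  have hsum (n : ℕ) := Summable.of_norm_bounded (hasSum_pow_div_factorial r).summable
    (norm_steinSolution_term_le hr hh n)
  cases n with
  | zero =>
    have e := h0.summable.tsum_eq_zero_add
    rw [h0.tsum_eq] at e
    simp only [steinSolution, mul_neg, ← tsum_mul_left, Nat.cast_zero, zero_mul, sub_zero]
    have : (∑' m : ℕ, r * (r ^ m * (Nat.factorial 0 / (0 + m + 1).factorial : ℝ) * h (0 + m + 1)))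
        = ∑' m : ℕ, r ^ (m + 1) / ((m + 1).factorial : ℝ) * h (m + 1) := by
      congr 1; ext m; simp; ring
    rw [this]
    simp at e
    linarith
  | succ n =>
    simp only [steinSolution, mul_neg, ← tsum_mul_left]
    have e := ((hsum n).mul_left ((n + 1 : ℕ) : ℝ)).tsum_eq_zero_add
    rw [e]
    have h1 : ((n + 1 : ℕ) : ℝ) * (r ^ 0 * (n.factorial / (n + 0 + 1).factorial : ℝ)
        * h (n + 0 + 1)) = h (n + 1) := by
      have : (n.factorial : ℝ) ≠ 0 := by positivity
      have : ((n : ℝ) + 1) ≠ 0 := by positivity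
      simp [Nat.factorial_succ]; field_simp
    have h2 : (∑' m : ℕ, ((n + 1 : ℕ) : ℝ) * (r ^ (m + 1)
          * (n.factorial / (n + (m + 1) + 1).factorial : ℝ) * h (n + (m + 1) + 1)))
        = ∑' m : ℕ, r * (r ^ m * ((n + 1).factorial / (n + 1 + m + 1).factorial : ℝ)
          * h (n + 1 + m + 1)) := by
      congr 1; ext m
      rw [show n + (m + 1) + 1 = n + 1 + m + 1 by ring, Nat.factorial_succ n]
      push_cast; ring
    rw [h1, h2]
    ring

/-- Bounded solutions of the Stein equation for the indicator function of `A`. -/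
theorem exists_steinSolution_indicator {r : ℝ} (hr : 0 ≤ r) (A : Set ℕ) :
    ∃ f : ℕ → ℝ, (∀ n, |f n| ≤ Real.exp r) ∧
      ∀ n : ℕ, r * f (n + 1) - n * f n = A.indicator 1 n - poissonLaw r A := by
  set h : ℕ → ℝ := fun n => A.indicator 1 n - poissonLaw r A with hdef
  obtain ⟨h0, h1⟩ := poissonLaw_mem_Icc hr A
  have hh (n : ℕ) : |h n| ≤ 1 := by
    by_cases hn : n ∈ A <;> simp only [hdef, hn, Set.indicator_of_mem, Set.indicator_of_notMem,
      not_false_eq_true, Pi.one_apply] <;> rw [abs_le] <;> constructor <;> linarith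
  refine ⟨steinSolution r h, abs_steinSolution_le hr hh, steinSolution_equation hr hh ?_⟩
  simpa [hdef, mul_sub] using (hasSum_indicator_poissonLaw r A).sub
    ((hasSum_pow_div_factorial r).mul_right (poissonLaw r A))

/-- Chen–Stein estimate for a sum `∑ j ∈ J, I j` of locally dependent indicators on a finite
uniform probability space: `near j` is the dependence neighbourhood of `j`. -/
theorem abs_sum_steinOperator_le {X ι : Type*} [Fintype X] [DecidableEq ι] (J : Finset ι)
    (I : ι → X → ℕ) (near : ι → Finset ι) (p r C D : ℝ) (f : ℕ → ℝ)
    (hI : ∀ j x, I j x ≤ 1) (hp : 0 ≤ p) (hf : ∀ n, |f n| ≤ C)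
    (hnear : ∀ j ∈ J, near j ⊆ J.erase j) (hcard : ∀ j ∈ J, ((near j).card : ℝ) ≤ D)
    (hindep : ∀ j ∈ J, ∀ g : ℕ → ℝ,
      ∑ x, (I j x : ℝ) * g (∑ i ∈ (J.erase j) \ near j, I i x)
        = p * ∑ x, g (∑ i ∈ (J.erase j) \ near j, I i x))
    (hpair : ∀ j ∈ J, ∀ i ∈ near j,
      ∑ x, (I j x : ℝ) * (I i x : ℝ) ≤ p ^ 2 * Fintype.card X) :
    |∑ x, (r * f (∑ j ∈ J, I j x + 1) - (∑ j ∈ J, I j x : ℕ) * f (∑ j ∈ J, I j x))|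
      ≤ C * Fintype.card X * (|r - J.card * p| + 2 * J.card * ((2 * D + 1) * p ^ 2)) := by
  classical
  have hC : 0 ≤ C := (abs_nonneg _).trans (hf 0)
  set W : X → ℕ := fun x => ∑ j ∈ J, I j x with hW
  set V : ι → X → ℕ := fun j x => ∑ i ∈ (J.erase j) \ near j, I i x with hV
  set Y : ι → X → ℕ := fun j x => ∑ i ∈ near j, I i x with hY
  have hdecomp : ∀ j ∈ J, ∀ x, W x = I j x + Y j x + V j x := by
    intro j hj x
    have h₁ := Finset.add_sum_erase J (fun i => I i x) hj
    have h₂ := Finset.sum_sdiff (f := fun i => I i x) (hnear j hj)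
    simp only [hW, hV, hY]
    omega
  have hmean : ∀ j ∈ J, ∑ x, (I j x : ℝ) = p * Fintype.card X := by
    intro j hj
    simpa using hindep j hj (fun _ => 1)
  have hdiff (m n : ℕ) : |f m - f n| ≤ 2 * C := by
    have := abs_sub (f m) (f n)
    linarith [hf m, hf n]
  have hlocal : ∀ j ∈ J, |∑ x, (p * f (W x + 1) - I j x * f (W x))|
      ≤ 2 * C * ((2 * D + 1) * p ^ 2 * Fintype.card X) := by
    intro j hj
    have hpoint : ∀ x, |p * (f (W x + 1) - f (V j x + 1)) - I j x * (f (W x) - f (V j x + 1))|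
        ≤ 2 * C * (p * I j x + p * Y j x + I j x * Y j x) := by
      intro x
      have h₁ : |f (W x + 1) - f (V j x + 1)| ≤ 2 * C * (I j x + Y j x) := by
        rcases Nat.eq_zero_or_pos (I j x + Y j x) with h | h
        · have : W x = V j x := by rw [hdecomp j hj x, h, zero_add]
          rw [this, sub_self, abs_zero]; positivity
        · have h' : (1 : ℝ) ≤ I j x + Y j x := by exact_mod_cast h
          nlinarith [hdiff (W x + 1) (V j x + 1)]
      have h₂ : I j x * |f (W x) - f (V j x + 1)| ≤ 2 * C * (I j x * Y j x) := by
        rcases Nat.eq_zero_or_pos (I j x) with h | h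
        · simp [h]
        have h1 : I j x = 1 := le_antisymm (hI j x) h
        rw [h1, Nat.cast_one, one_mul, one_mul]
        rcases Nat.eq_zero_or_pos (Y j x) with h | h
        · have : W x = V j x + 1 := by rw [hdecomp j hj x, h, h1]; ring
          rw [this, sub_self, abs_zero]; positivity
        · have h' : (1 : ℝ) ≤ Y j x := by exact_mod_cast h
          nlinarith [hdiff (W x) (V j x + 1)]
      calc _ ≤ |p * (f (W x + 1) - f (V j x + 1))| + |I j x * (f (W x) - f (V j x + 1))| :=
            abs_sub _ _
        _ = p * |f (W x + 1) - f (V j x + 1)| + I j x * |f (W x) - f (V j x + 1)| := by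
            rw [abs_mul, abs_mul, abs_of_nonneg hp, Nat.abs_cast]
        _ ≤ p * (2 * C * (I j x + Y j x)) + 2 * C * (I j x * Y j x) := by gcongr
        _ = _ := by ring
    have hzero : ∑ x, (p * f (V j x + 1) - I j x * f (V j x + 1)) = 0 := by
      rw [Finset.sum_sub_distrib, ← Finset.mul_sum, sub_eq_zero]
      exact (hindep j hj (fun n => f (n + 1))).symm
    have hYmean : ∑ x, (Y j x : ℝ) ≤ D * (p * Fintype.card X) := by
      calc ∑ x, (Y j x : ℝ) = ∑ i ∈ near j, ∑ x, (I i x : ℝ) := by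
            simp only [hY, Nat.cast_sum]; exact Finset.sum_comm
        _ = (near j).card * (p * Fintype.card X) := by
            rw [Finset.sum_congr rfl fun i hi =>
              hmean i (Finset.mem_of_mem_erase (hnear j hj hi))]
            simp
        _ ≤ _ := by gcongr; exact hcard j hj
    have hIY : ∑ x, (I j x : ℝ) * Y j x ≤ D * (p ^ 2 * Fintype.card X) := by
      calc ∑ x, (I j x : ℝ) * Y j x = ∑ i ∈ near j, ∑ x, (I j x : ℝ) * I i x := by
            simp only [hY, Nat.cast_sum, Finset.mul_sum]; exact Finset.sum_comm
        _ ≤ ∑ i ∈ near j, p ^ 2 * Fintype.card X := Finset.sum_le_sum (hpair j hj)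
        _ = (near j).card * (p ^ 2 * Fintype.card X) := by simp
        _ ≤ _ := by gcongr; exact hcard j hj
    calc |∑ x, (p * f (W x + 1) - I j x * f (W x))|
        = |∑ x, (p * (f (W x + 1) - f (V j x + 1)) - I j x * (f (W x) - f (V j x + 1)))| := by
          rw [← sub_zero (∑ x, (p * f (W x + 1) - I j x * f (W x))), ← hzero,
            ← Finset.sum_sub_distrib]
          congr 1
          exact Finset.sum_congr rfl fun x _ => by ring
      _ ≤ ∑ x, 2 * C * (p * I j x + p * Y j x + I j x * Y j x) :=
          (Finset.abs_sum_le_sum_abs _ _).trans (Finset.sum_le_sum fun x _ => hpoint x)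
      _ = 2 * C * (p * ∑ x, (I j x : ℝ) + p * ∑ x, (Y j x : ℝ) + ∑ x, (I j x : ℝ) * Y j x) := by
          simp only [← Finset.mul_sum, Finset.sum_add_distrib]
      _ ≤ 2 * C * (p * (p * Fintype.card X) + p * (D * (p * Fintype.card X))
            + D * (p ^ 2 * Fintype.card X)) := by
          rw [hmean j hj]; gcongr
      _ = _ := by ring
  calc |∑ x, (r * f (W x + 1) - (W x : ℝ) * f (W x))|
      = |(r - J.card * p) * ∑ x, f (W x + 1)
          + ∑ j ∈ J, ∑ x, (p * f (W x + 1) - I j x * f (W x))| := by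
        rw [Finset.sum_comm, Finset.mul_sum, ← Finset.sum_add_distrib]
        congr 1
        refine Finset.sum_congr rfl fun x _ => ?_
        have hWx : (W x : ℝ) = ∑ j ∈ J, (I j x : ℝ) := Nat.cast_sum _ _
        rw [Finset.sum_sub_distrib, Finset.sum_const, ← Finset.sum_mul, ← hWx, nsmul_eq_mul]
        ring
    _ ≤ |r - J.card * p| * ∑ x : X, C
          + ∑ j ∈ J, 2 * C * ((2 * D + 1) * p ^ 2 * Fintype.card X) := by
        refine (abs_add_le _ _).trans (add_le_add ?_ ?_)
        · rw [abs_mul]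
          gcongr
          exact (Finset.abs_sum_le_sum_abs _ _).trans (Finset.sum_le_sum fun x _ => hf _)
        · exact (Finset.abs_sum_le_sum_abs _ _).trans (Finset.sum_le_sum hlocal)
    _ = _ := by
        simp only [Finset.sum_const, nsmul_eq_mul, Finset.card_univ]
        ring

/-- If `φ` is equidistributed along translations that leave `G` invariant, then each fibre of `φ`
carries the same share of the sum of `G`. -/
theorem sum_fiber_eq_of_translation {X H : Type*} [Fintype X] [AddGroup X] [Fintype H]
    [AddGroup H] [DecidableEq H] (φ : X → H) (s : H → X) (G : X → ℝ)
    (hφ : ∀ x v, φ (x + s v) = φ x + v) (hG : ∀ x v, G (x + s v) = G x) (c : H) :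
    ∑ x, (if φ x = c then 1 else 0) * G x = (Fintype.card H : ℝ)⁻¹ * ∑ x, G x := by
  have hshift (v : H) : ∑ x, (if φ x = c + v then 1 else 0) * G x
      = ∑ x, (if φ x = c then 1 else 0) * G x := by
    rw [← Equiv.sum_comp (Equiv.addRight (s v))]
    refine Finset.sum_congr rfl fun x _ => ?_
    simp [hφ, hG]
  have hcard : (Fintype.card H : ℝ) ≠ 0 := by
    have : Nonempty H := ⟨0⟩
    exact_mod_cast Fintype.card_ne_zero
  rw [eq_inv_mul_iff_mul_eq₀ hcard]
  calc (Fintype.card H : ℝ) * ∑ x, (if φ x = c then 1 else 0) * G x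
      = ∑ v : H, ∑ x, (if φ x = c + v then 1 else 0) * G x := by
        rw [Finset.sum_congr rfl fun v _ => hshift v]
        simp only [Finset.sum_const, Finset.card_univ, nsmul_eq_mul]
    _ = ∑ v : H, ∑ x, (if φ x = v then 1 else 0) * G x :=
        Equiv.sum_comp (Equiv.addLeft c) fun v => ∑ x, (if φ x = v then 1 else 0) * G x
    _ = ∑ x, G x := by
        rw [Finset.sum_comm]
        simp

theorem occursAt_congr {b k : ℕ} {x x' : ℕ → Fin b} {j : ℕ} (w : Fin k → Fin b)
    (h : ∀ t < k, x (j - 1 + t) = x' (j - 1 + t)) : OccursAt x j w ↔ OccursAt x' j w :=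
  forall_congr' fun t => by rw [h t t.2]

section FiniteModel

variable {b : ℕ} [NeZero b] {k L : ℕ}

/-- Extension of a finite word to an infinite one by zeros. -/
def extendZero (y : Fin L → Fin b) (t : ℕ) : Fin b := if h : t < L then y ⟨t, h⟩ else 0

/-- Truncation of an infinite word to its first `L` letters. -/
def truncate (L : ℕ) (x : ℕ → Fin b) (t : Fin L) : Fin b := x t

theorem extendZero_truncate (x : ℕ → Fin b) {t : ℕ} (ht : t < L) :
    extendZero (truncate L x) t = x t := by simp [extendZero, truncate, ht]

theorem extendZero_add (y z : Fin L → Fin b) (t : ℕ) :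
    extendZero (y + z) t = extendZero y t + extendZero z t := by
  unfold extendZero; split_ifs <;> simp

/-- The defect between the window of `y` at position `j` and the word `w`. -/
def windowDefect (j : ℕ) (z : (Fin L → Fin b) × (Fin k → Fin b)) (t : Fin k) : Fin b :=
  extendZero z.1 (j - 1 + t) - z.2 t

theorem windowDefect_eq_zero_iff (j : ℕ) (z : (Fin L → Fin b) × (Fin k → Fin b)) :
    windowDefect j z = 0 ↔ OccursAt (extendZero z.1) j z.2 := by
  simp [funext_iff, windowDefect, sub_eq_zero, OccursAt]

theorem windowDefect_add (j : ℕ) (z z' : (Fin L → Fin b) × (Fin k → Fin b)) :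
    windowDefect j (z + z') = windowDefect j z + windowDefect j z' := by
  ext1 t
  simp only [windowDefect, Prod.fst_add, Prod.snd_add, extendZero_add, Pi.add_apply]
  abel

/-- The indicator of an occurrence at `j`. -/
def occ (j : ℕ) (z : (Fin L → Fin b) × (Fin k → Fin b)) : ℕ :=
  if OccursAt (extendZero z.1) j z.2 then 1 else 0

theorem cast_occ (j : ℕ) (z : (Fin L → Fin b) × (Fin k → Fin b)) :
    (occ j z : ℝ) = if windowDefect j z = 0 then 1 else 0 := by
  simp [occ, windowDefect_eq_zero_iff]

theorem sum_occ_mul_of_far {j : ℕ} (hj : 1 ≤ j) (hjL : j + k ≤ L) (F : Finset ℕ)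
    (hF : ∀ i ∈ F, 1 ≤ i ∧ (i + k ≤ j ∨ j + k ≤ i)) (g : ℕ → ℝ) :
    ∑ z : (Fin L → Fin b) × (Fin k → Fin b), (occ j z : ℝ) * g (∑ i ∈ F, occ i z)
      = ((b : ℝ) ^ k)⁻¹ * ∑ z : (Fin L → Fin b) × (Fin k → Fin b), g (∑ i ∈ F, occ i z) := by
  let u : (Fin k → Fin b) → ℕ → Fin b := fun v t =>
    if h : j - 1 ≤ t ∧ t - (j - 1) < k then v ⟨t - (j - 1), h.2⟩ else 0
  let s : (Fin k → Fin b) → (Fin L → Fin b) × (Fin k → Fin b) := fun v => (truncate L (u v), 0)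
  have hs (v : Fin k → Fin b) : windowDefect j (s v) = v := by
    ext1 t
    have ht := t.2
    simp only [windowDefect, s, extendZero_truncate (u v) (show j - 1 + t < L by omega)]
    simp only [u, Pi.zero_apply, sub_zero, add_tsub_cancel_left]
    rw [dif_pos ⟨Nat.le_add_right _ _, t.2⟩]
  have hfar (v : Fin k → Fin b) (i : ℕ) (hi : i ∈ F) : windowDefect i (s v) = 0 := by
    ext1 t
    have ht := t.2
    have hi' := hF i hi
    have hout : ¬ (j - 1 ≤ i - 1 + (t : ℕ) ∧ i - 1 + (t : ℕ) - (j - 1) < k) := by omega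
    simp only [windowDefect, s, extendZero]
    split_ifs
    · simp only [truncate, u, hout]; simp
    · simp
  have := sum_fiber_eq_of_translation (windowDefect j) s
    (fun z : (Fin L → Fin b) × (Fin k → Fin b) => g (∑ i ∈ F, occ i z))
    (fun z v => by rw [windowDefect_add, hs]) (fun z v => by
      congr 1
      refine Finset.sum_congr rfl fun i hi => ?_
      simp only [occ, ← windowDefect_eq_zero_iff, windowDefect_add, hfar v i hi, add_zero]) 0
  simpa [cast_occ] using this

theorem exists_prescribed_differences {H : Type*} [AddCommGroup H] {i j : ℕ} (hij : i < j)
    (v : ℕ → H) (k : ℕ) : ∃ u : ℕ → H, ∀ t < k, u (j + t) - u (i + t) = v t := by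
  induction k with
  | zero => exact ⟨0, by simp⟩
  | succ k ih =>
    obtain ⟨u, hu⟩ := ih
    refine ⟨Function.update u (j + k) (v k + u (i + k)), fun t ht => ?_⟩
    rw [Function.update_of_ne (show i + t ≠ j + k by omega)]
    rcases Nat.lt_succ_iff_lt_or_eq.1 ht with h | rfl
    · rw [Function.update_of_ne (by omega), hu t h]
    · simp

theorem sum_occ_mul_occ_of_lt {i j : ℕ} (hi : 1 ≤ i) (hij : i < j) (hjL : j + k ≤ L) :
    ∑ z : (Fin L → Fin b) × (Fin k → Fin b), (occ i z : ℝ) * (occ j z : ℝ)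
      = (((b : ℝ) ^ k)⁻¹) ^ 2 * Fintype.card ((Fin L → Fin b) × (Fin k → Fin b)) := by
  have hu (v : (Fin k → Fin b) × (Fin k → Fin b)) : ∃ u : ℕ → Fin b, ∀ t : Fin k,
      u (j - 1 + t) - u (i - 1 + t) = v.2 t - v.1 t := by
    obtain ⟨u, hu⟩ := exists_prescribed_differences (show i - 1 < j - 1 by omega)
      (fun t => if h : t < k then v.2 ⟨t, h⟩ - v.1 ⟨t, h⟩ else 0) k
    exact ⟨u, fun t => by simpa using hu t t.2⟩
  choose u hu using hu
  let s : (Fin k → Fin b) × (Fin k → Fin b) → (Fin L → Fin b) × (Fin k → Fin b) := fun v =>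
    (truncate L (u v), fun t => u v (i - 1 + t) - v.1 t)
  have hs₁ (v) : windowDefect i (s v) = v.1 := by
    ext1 t
    have ht := t.2
    simp [windowDefect, s, extendZero_truncate (u v) (show i - 1 + t < L by omega)]
  have hs₂ (v) : windowDefect j (s v) = v.2 := by
    ext1 t
    have ht := t.2
    simp only [windowDefect, s, extendZero_truncate (u v) (show j - 1 + t < L by omega)]
    rw [sub_sub_eq_add_sub, add_sub_right_comm, hu v t, sub_add_cancel]
  have := sum_fiber_eq_of_translation
    (fun z : (Fin L → Fin b) × (Fin k → Fin b) => (windowDefect i z, windowDefect j z)) s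
    (fun _ => 1) (fun z v => by simp only [windowDefect_add, hs₁, hs₂]; rfl) (fun _ _ => rfl) 0
  have hprod (z : (Fin L → Fin b) × (Fin k → Fin b)) : (occ i z : ℝ) * (occ j z : ℝ)
      = (if (windowDefect i z, windowDefect j z) = 0 then 1 else 0) * 1 := by
    rw [cast_occ, cast_occ, mul_one, ite_zero_mul_ite_zero, mul_one]
    simp only [Prod.ext_iff, Prod.fst_zero, Prod.snd_zero]
  rw [Finset.sum_congr rfl fun z _ => hprod z, this]
  simp [sq]

end FiniteModel

theorem IsUnifProductMeasure.isProbabilityMeasure {b : ℕ} {ν : Measure (ℕ → Fin b)}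
    (hν : IsUnifProductMeasure b ν) : IsProbabilityMeasure ν :=
  ⟨by simpa using hν 0 Fin.elim0⟩

theorem IsUnifProductMeasure.prod_muK_preimage {b k L : ℕ} [NeZero b] {ν : Measure (ℕ → Fin b)}
    (hν : IsUnifProductMeasure b ν) (T : Finset ((Fin L → Fin b) × (Fin k → Fin b))) :
    ((ν.prod (muK b k)) ((fun z : (ℕ → Fin b) × (Fin k → Fin b) => (truncate L z.1, z.2)) ⁻¹'
      (T : Set ((Fin L → Fin b) × (Fin k → Fin b))))).toReal
      = (T.card : ℝ) / Fintype.card ((Fin L → Fin b) × (Fin k → Fin b)) := by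
  have hmuK : IsFiniteMeasure (muK b k) := by
    refine ⟨?_⟩
    rw [muK, Measure.smul_apply, smul_eq_mul]
    refine ENNReal.mul_lt_top (ENNReal.inv_lt_top.2 ?_) (measure_lt_top _ _)
    exact pos_iff_ne_zero.2 (pow_ne_zero _ (Nat.cast_ne_zero.2 (NeZero.ne b)))
  have hmeas : Measurable fun z : (ℕ → Fin b) × (Fin k → Fin b) => (truncate L z.1, z.2) := by
    refine Measurable.prodMk (measurable_pi_lambda _ fun t => ?_) measurable_snd
    exact (measurable_pi_apply (t : ℕ)).comp measurable_fst
  rw [← sum_measure_preimage_singleton T fun z _ => hmeas (measurableSet_singleton z)]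
  have hpoint (z : (Fin L → Fin b) × (Fin k → Fin b)) : (ν.prod (muK b k))
      ((fun z : (ℕ → Fin b) × (Fin k → Fin b) => (truncate L z.1, z.2)) ⁻¹' {z})
        = ((b : ENNReal)⁻¹) ^ L * ((b : ENNReal) ^ k)⁻¹ := by
    have hset : (fun z : (ℕ → Fin b) × (Fin k → Fin b) => (truncate L z.1, z.2)) ⁻¹' {z}
        = {x : ℕ → Fin b | ∀ t : Fin L, x (t : ℕ) = z.1 t} ×ˢ {z.2} := by
      ext y
      simp [Prod.ext_iff, funext_iff, truncate]
    rw [hset, Measure.prod_prod, hν, muK, Measure.smul_apply, Measure.count_singleton,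
      smul_eq_mul, mul_one]
  rw [Finset.sum_congr rfl fun z _ => hpoint z]
  simp [div_eq_mul_inv, mul_comm]

theorem Mx_eq_sum {b k : ℕ} {S : Set ℝ} {J : Finset ℕ}
    (hJ : ∀ j : ℕ, j ∈ J ↔ 1 ≤ j ∧ (j : ℝ) / (b : ℝ) ^ k ∈ S) (x : ℕ → Fin b)
    (w : Fin k → Fin b) : Mx b k S x w = ∑ j ∈ J, if OccursAt x j w then 1 else 0 := by
  rw [Finset.sum_boole, Mx, Nat.cast_id, ← Set.ncard_coe_finset]
  congr 1
  ext j
  simp [hJ, and_assoc]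

theorem lawM_eq_sum_indicator {b k L : ℕ} [NeZero b] {ν : Measure (ℕ → Fin b)}
    (hν : IsUnifProductMeasure b ν) {S : Set ℝ} {J : Finset ℕ}
    (hJ : ∀ j : ℕ, j ∈ J ↔ 1 ≤ j ∧ (j : ℝ) / (b : ℝ) ^ k ∈ S) (hL : ∀ j ∈ J, j + k ≤ L)
    (A : Set ℕ) :
    lawM b k ν S A = (∑ z : (Fin L → Fin b) × (Fin k → Fin b),
      A.indicator (1 : ℕ → ℝ) (∑ j ∈ J, occ j z))
        / Fintype.card ((Fin L → Fin b) × (Fin k → Fin b)) := by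
  classical
  have hsum : (∑ z : (Fin L → Fin b) × (Fin k → Fin b),
      A.indicator (1 : ℕ → ℝ) (∑ j ∈ J, occ j z))
        = ((Finset.univ.filter fun z : (Fin L → Fin b) × (Fin k → Fin b) =>
          ∑ j ∈ J, occ j z ∈ A).card : ℝ) := by
    simp [Set.indicator_apply]
  rw [hsum, ← hν.prod_muK_preimage, lawM]
  congr 2
  ext z
  have : Mx b k S z.1 z.2 = ∑ j ∈ J, occ j (truncate L z.1, z.2) := by
    rw [Mx_eq_sum hJ]
    refine Finset.sum_congr rfl fun j hj => ?_
    have := hL j hj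
    have hj1 := ((hJ j).1 hj).1
    simp only [occ, occursAt_congr z.2 fun t ht =>
      (extendZero_truncate z.1 (show j - 1 + t < L by omega)).symm]
  simp [this]

theorem abs_lawM_sub_poissonLaw_le {b k : ℕ} [NeZero b] {ν : Measure (ℕ → Fin b)}
    (hν : IsUnifProductMeasure b ν) {S : Set ℝ} {J : Finset ℕ}
    (hJ : ∀ j : ℕ, j ∈ J ↔ 1 ≤ j ∧ (j : ℝ) / (b : ℝ) ^ k ∈ S) {r : ℝ} (hr : 0 ≤ r)
    (A : Set ℕ) :
    |lawM b k ν S A - poissonLaw r A| ≤ Real.exp r * (|r - J.card / (b : ℝ) ^ k|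
      + 2 * (J.card / (b : ℝ) ^ k) * ((4 * k + 1) / (b : ℝ) ^ k)) := by
  obtain ⟨f, hf, hfA⟩ := exists_steinSolution_indicator hr A
  set L := J.sup id + k with hL
  have hJL : ∀ j ∈ J, j + k ≤ L := fun j hj =>
    Nat.add_le_add_right (Finset.le_sup (f := id) hj) k
  set near : ℕ → Finset ℕ := fun j => (J.erase j).filter fun i => i < j + k ∧ j < i + k with hnear
  have hcard : ∀ j ∈ J, ((near j).card : ℝ) ≤ 2 * k := by
    intro j _
    have hsub : near j ⊆ Finset.Ico (j - k) (j + k) := by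
      intro i hi
      simp only [hnear, Finset.mem_filter] at hi
      rw [Finset.mem_Ico]
      omega
    have h := Finset.card_le_card hsub
    rw [Nat.card_Ico] at h
    exact_mod_cast h.trans (by omega : j + k - (j - k) ≤ 2 * k)
  have hmain := abs_sum_steinOperator_le (X := (Fin L → Fin b) × (Fin k → Fin b)) J occ near
    ((b : ℝ) ^ k)⁻¹ r (Real.exp r) (2 * k) f
    (fun j z => by unfold occ; split_ifs <;> simp) (by positivity) hf
    (fun j _ => Finset.filter_subset _ _) hcard
    (fun j hj g => by
      refine sum_occ_mul_of_far ((hJ j).1 hj).1 (hJL j hj) _ (fun i hi => ?_) g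
      simp only [hnear, Finset.mem_sdiff, Finset.mem_filter, Finset.mem_erase] at hi
      exact ⟨((hJ i).1 hi.1.2).1, by by_contra h; exact hi.2 ⟨hi.1, by omega, by omega⟩⟩)
    (fun j hj i hi => by
      simp only [hnear, Finset.mem_filter, Finset.mem_erase] at hi
      rcases lt_or_gt_of_ne hi.1.1 with h | h
      · rw [← sum_occ_mul_occ_of_lt ((hJ i).1 hi.1.2).1 h (hJL j hj)]
        exact (Finset.sum_congr rfl fun z _ => mul_comm _ _).le
      · exact (sum_occ_mul_occ_of_lt ((hJ j).1 hj).1 h (hJL i hi.1.2)).le)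
  have hX : (0 : ℝ) < Fintype.card ((Fin L → Fin b) × (Fin k → Fin b)) := by
    exact_mod_cast Fintype.card_pos
  rw [lawM_eq_sum_indicator hν hJ hJL]
  simp only [hfA, Finset.sum_sub_distrib, Finset.sum_const, Finset.card_univ, nsmul_eq_mul]
    at hmain
  rw [div_sub' hX.ne', abs_div, abs_of_pos hX, div_le_iff₀ hX]
  refine hmain.trans (le_of_eq ?_)
  simp only [div_eq_mul_inv]
  ring

theorem card_Ico_floor_ceil_sub_le {p q B : ℝ} (hp : 0 ≤ p) (hB : 0 ≤ B) :
    |((Finset.Ico (⌊p * B⌋₊ + 1) ⌈q * B⌉₊).card : ℝ) - max (q - p) 0 * B| ≤ 1 := by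
  rw [Nat.card_Ico]
  have h₁ := Nat.floor_le (mul_nonneg hp hB)
  have h₂ := Nat.lt_floor_add_one (p * B)
  rcases le_total q p with h | h
  · have hle : ⌈q * B⌉₊ ≤ ⌊p * B⌋₊ + 1 := by
      refine Nat.ceil_le.2 ?_
      push_cast
      nlinarith
    rw [Nat.sub_eq_zero_of_le hle, max_eq_right (by linarith)]
    simp
  · have h₃ := Nat.le_ceil (q * B)
    have h₄ := Nat.ceil_lt_add_one (mul_nonneg (hp.trans h) hB)
    have h₅ : p * B ≤ q * B := by gcongr
    rw [max_eq_left (by linarith), sub_mul, abs_le]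
    rcases le_total (⌊p * B⌋₊ + 1) ⌈q * B⌉₊ with h' | h'
    · rw [Nat.cast_sub h']
      push_cast
      constructor <;> linarith
    · rw [Nat.sub_eq_zero_of_le h']
      have : (⌈q * B⌉₊ : ℝ) ≤ ⌊p * B⌋₊ + 1 := by exact_mod_cast h'
      push_cast
      constructor <;> linarith

/-- The number of lattice points of mesh `B⁻¹` in a finite union of intervals differs from
`B` times the length by a bounded amount. -/
theorem IsFinRatIntervalUnion.exists_positions {S : Set ℝ} (hS : IsFinRatIntervalUnion S) :
    ∃ n : ℕ, ∀ B : ℝ, 0 < B → ∃ J : Finset ℕ, (∀ j : ℕ, j ∈ J ↔ 1 ≤ j ∧ (j : ℝ) / B ∈ S) ∧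
      |(J.card : ℝ) - (volume S).toReal * B| ≤ n := by
  obtain ⟨n, p, q, hp, hdisj, rfl⟩ := hS
  refine ⟨n, fun B hB => ?_⟩
  have hp' (m : Fin n) : (0 : ℝ) ≤ p m := by exact_mod_cast hp m
  let I : Fin n → Finset ℕ := fun m => Finset.Ico (⌊(p m : ℝ) * B⌋₊ + 1) ⌈(q m : ℝ) * B⌉₊
  have hI (m : Fin n) (j : ℕ) : j ∈ I m ↔ (j : ℝ) / B ∈ Set.Ioo (p m : ℝ) (q m) := by
    rw [Finset.mem_Ico, Nat.succ_le_iff, Nat.floor_lt (mul_nonneg (hp' m) hB.le), Nat.lt_ceil,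
      Set.mem_Ioo, lt_div_iff₀ hB, div_lt_iff₀ hB]
  have hcard : (Finset.univ.biUnion I).card = ∑ m, (I m).card := by
    refine Finset.card_biUnion fun m _ l _ hml => Finset.disjoint_left.2 fun j hm hl => ?_
    exact Set.disjoint_left.1 (hdisj hml) ((hI m j).1 hm) ((hI l j).1 hl)
  have hvol : (volume (⋃ m, Set.Ioo (p m : ℝ) (q m))).toReal
      = ∑ m, max ((q m : ℝ) - p m) 0 := by
    rw [measure_iUnion hdisj fun m => measurableSet_Ioo, tsum_fintype,
      ENNReal.toReal_sum fun m _ => measure_Ioo_lt_top.ne]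
    simp [ENNReal.toReal_ofReal']
  refine ⟨Finset.univ.biUnion I, fun j => ?_, ?_⟩
  · simp only [Finset.mem_biUnion, Finset.mem_univ, true_and, Set.mem_iUnion, hI]
    refine ⟨fun ⟨m, hm⟩ => ⟨?_, m, hm⟩, fun h => h.2⟩
    have := (Finset.mem_Ico.1 ((hI m j).2 hm)).1
    omega
  · rw [hcard, hvol, Nat.cast_sum, Finset.sum_mul, ← Finset.sum_sub_distrib]
    calc _ ≤ ∑ m : Fin n, (1 : ℝ) := (Finset.abs_sum_le_sum_abs _ _).trans
          (Finset.sum_le_sum fun m _ => card_Ico_floor_ceil_sub_le (hp' m) hB.le)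
      _ = n := by simp

theorem stmt8 (b : ℕ) (hb : 2 ≤ b) (ν : Measure (ℕ → Fin b))
    (hν : IsUnifProductMeasure b ν) (S : Set ℝ) (hS : IsFinRatIntervalUnion S) :
    Tendsto (fun k : ℕ => dTV (lawM b k ν S) (poissonLaw (volume S).toReal))
      atTop (nhds 0) := by
  have : NeZero b := ⟨by omega⟩
  have hb1 : (1 : ℝ) < b := by exact_mod_cast hb
  have hB (k : ℕ) : (0 : ℝ) < (b : ℝ) ^ k := by positivity
  set r := (volume S).toReal with hr
  have hr0 : 0 ≤ r := ENNReal.toReal_nonneg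
  obtain ⟨n, hn⟩ := hS.exists_positions
  choose J hJ hJcard using fun k => hn ((b : ℝ) ^ k) (hB k)
  have hdist (k : ℕ) : |r - (J k).card / (b : ℝ) ^ k| ≤ n / (b : ℝ) ^ k := by
    rw [abs_sub_comm, div_sub' (hB k).ne', abs_div, abs_of_pos (hB k), mul_comm]
    gcongr
    exact hJcard k
  have hinv : Tendsto (fun k : ℕ => (n : ℝ) / (b : ℝ) ^ k) atTop (nhds 0) := by
    simpa [div_eq_mul_inv] using (tendsto_pow_const_div_const_pow_of_one_lt 0 hb1).const_mul (n : ℝ)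
  have habs : Tendsto (fun k : ℕ => |r - (J k).card / (b : ℝ) ^ k|) atTop (nhds 0) :=
    squeeze_zero (fun _ => abs_nonneg _) hdist hinv
  have hmean : Tendsto (fun k : ℕ => ((J k).card : ℝ) / (b : ℝ) ^ k) atTop (nhds r) := by
    have h := (tendsto_zero_iff_abs_tendsto_zero _).2 habs
    simpa using tendsto_const_nhds (x := r) |>.sub h
  have hwindow : Tendsto (fun k : ℕ => (4 * (k : ℝ) + 1) / (b : ℝ) ^ k) atTop (nhds 0) := by
    have h₁ := (tendsto_pow_const_div_const_pow_of_one_lt 1 hb1).const_mul (4 : ℝ)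
    have h₀ := tendsto_pow_const_div_const_pow_of_one_lt 0 hb1
    simpa [add_div, mul_div_assoc] using h₁.add h₀
  have hbound : Tendsto (fun k : ℕ => Real.exp r * (|r - (J k).card / (b : ℝ) ^ k|
      + 2 * ((J k).card / (b : ℝ) ^ k) * ((4 * k + 1) / (b : ℝ) ^ k))) atTop (nhds 0) := by
    simpa using (habs.add ((hmean.const_mul 2).mul hwindow)).const_mul (Real.exp r)
  refine squeeze_zero (fun k => Real.iSup_nonneg fun A => abs_nonneg _) (fun k => ?_) hbound
  exact ciSup_le fun A => abs_lawM_sub_poissonLaw_le hν (hJ k) hr0 A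
end
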